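/- arXiv:2211.12381 — 2 statements merged into one kernel-verified Lean document; each statement's English description precedes it below -/
import Mathlib

section
/- Fix r ≥ 1 and let A = F_p[y^{1/p^∞}]/(y). The ring homomorphism θ : (Z/p^r)[M] → W_r(A) from the monoid algebra of M over Z/p^r to the length-r p-typical Witt vectors of A, determined by sending the basis element y^q to the Teichmüller representative [ȳ^q] for each q ∈ M, is well defined and surjective. -/
/-- The additive monoid `M = ℤ[1/p]_{≥ 0}` of nonnegative rational numbers whose
denominator is a power of `p`, realized as an additive submonoid of `ℚ`. -/
def Mp (p : ℕ) : AddSubmonoid ℚ where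
  carrier := {q | 0 ≤ q ∧ ∃ (k : ℕ) (m : ℤ), q * (p : ℚ) ^ k = m}
  zero_mem' := ⟨le_refl 0, 0, 0, by norm_num⟩
  add_mem' := by
    rintro a b ⟨ha, k, m, hm⟩ ⟨hb, l, n, hn⟩
    refine ⟨add_nonneg ha hb, k + l, m * (p : ℤ) ^ l + n * (p : ℤ) ^ k, ?_⟩
    push_cast
    calc (a + b) * (p : ℚ) ^ (k + l)
        = (a * (p : ℚ) ^ k) * (p : ℚ) ^ l + (b * (p : ℚ) ^ l) * (p : ℚ) ^ k := by
          rw [pow_add]; ring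
      _ = (m : ℚ) * (p : ℚ) ^ l + (n : ℚ) * (p : ℚ) ^ k := by rw [hm, hn]

/-- `F_p[y^{1/p^∞}]`, the monoid algebra of `M` over `F_p = ZMod p`. -/
abbrev Rp (p : ℕ) : Type := AddMonoidAlgebra (ZMod p) (Mp p)

/-- The basis element `y^q` of `F_p[y^{1/p^∞}]`, for `q ∈ M`. -/
noncomputable def ye (p : ℕ) (q : Mp p) : Rp p := AddMonoidAlgebra.single q 1

/-- `1 ∈ M`. -/
def oneM (p : ℕ) : Mp p := ⟨1, zero_le_one, 0, 1, by norm_num⟩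

/-- `1/p^k ∈ M`. -/
def pinvM (p : ℕ) (hp : p ≠ 0) (k : ℕ) : Mp p :=
  ⟨1 / (p : ℚ) ^ k, by positivity, k, 1, by
    have hp' : (p : ℚ) ≠ 0 := Nat.cast_ne_zero.mpr hp
    field_simp
    norm_num⟩

/-- The quotient ring `A = F_p[y^{1/p^∞}]/(y)`. -/
abbrev Ap (p : ℕ) : Type := Rp p ⧸ Ideal.span {ye p (oneM p)}

/-- The class `ȳ^q` of the basis element `y^q` in `A = F_p[y^{1/p^∞}]/(y)`. -/
noncomputable def ybar (p : ℕ) (q : Mp p) : Ap p :=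
  Ideal.Quotient.mk (Ideal.span {ye p (oneM p)}) (ye p q)

open WittVector in
/-- If the Frobenius of `A` is surjective, a subring of `W(A)` hitting every constant coefficient
is `p`-adically dense. -/
theorem WittVector.exists_mem_add_mul_p_pow {p : ℕ} [Fact p.Prime] {A : Type*} [CommRing A]
    [CharP A p] (hF : Function.Surjective (_root_.frobenius A p)) (S : Subring (WittVector p A))
    (hS : ∀ a : A, ∃ s ∈ S, s.coeff 0 = a) (n : ℕ) (x : WittVector p A) :
    ∃ s ∈ S, ∃ z, x = s + z * (p : WittVector p A) ^ n := by
  induction n with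
  | zero => exact ⟨0, S.zero_mem, x, by simp⟩
  | succ n ih =>
    obtain ⟨s, hs, z, rfl⟩ := ih
    obtain ⟨t, ht, htz⟩ := hS (z.coeff 0)
    have hzt : constantCoeff (z - t) = 0 := by
      rw [map_sub, sub_eq_zero]
      exact htz.symm
    obtain ⟨w, hw⟩ : ∃ w, frobenius w = (z - t).shift 1 := by
      rw [frobenius_eq_map_frobenius]
      exact map_surjective _ hF _
    have hzw : z - t = w * p := by
      rw [← verschiebung_frobenius, hw]
      exact eq_iterate_verschiebung (n := 1) fun i hi => by
        obtain rfl : i = 0 := by omega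
        exact hzt
    refine ⟨s + t * (p : WittVector p A) ^ n,
      S.add_mem hs (S.mul_mem ht (S.pow_mem (natCast_mem S p) n)), w, ?_⟩
    linear_combination (p : WittVector p A) ^ n * hzw

/-- `p ^ r` vanishes in the Witt vectors of length `r` over a ring of characteristic `p`. -/
theorem TruncatedWittVector.natCast_p_pow_eq_zero (p : ℕ) [Fact p.Prime] (r : ℕ) (A : Type*)
    [CommRing A] [CharP A p] : (p : TruncatedWittVector p r A) ^ r = 0 := by
  have h : (p : WittVector p A) ^ r ∈ RingHom.ker (WittVector.truncate (p := p) (R := A) r) :=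
    (WittVector.mem_ker_truncate r _).2 fun i hi => WittVector.coeff_p_pow_eq_zero p A hi.ne
  simpa using h

/-- A ring in which `n = 0` receives a ring homomorphism from `ZMod n`. -/
theorem nonempty_zmod_ringHom {R : Type*} [Ring R] {n : ℕ} (h : (n : R) = 0) :
    Nonempty (ZMod n →+* R) :=
  ⟨ZMod.castHom (ringChar.dvd h) R⟩

instance Ap.instNontrivial (p : ℕ) [Fact p.Prime] : Nontrivial (Ap p) := by
  refine Ideal.Quotient.nontrivial_iff.2 fun h => ?_
  obtain ⟨a, ha⟩ := Ideal.mem_span_singleton'.1 ((Ideal.eq_top_iff_one _).1 h)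
  have h0 : (a * ye p (oneM p)).coeff 0 = 0 :=
    AddMonoidAlgebra.coeff_mul_single_of_forall_add_ne _ _ fun d hd => by
      have h1 : (d : ℚ) + 1 = 0 := congrArg Subtype.val hd
      linarith [d.2.1]
  rw [ha] at h0
  simp [AddMonoidAlgebra.one_def] at h0

instance Ap.instCharP (p : ℕ) [Fact p.Prime] : CharP (Ap p) p :=
  charP_of_injective_algebraMap (algebraMap (ZMod p) (Ap p)).injective p

theorem ybar_zero (p : ℕ) : ybar p 0 = 1 := rfl

theorem ybar_add (p : ℕ) (a b : Mp p) : ybar p (a + b) = ybar p a * ybar p b := by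
  have h : ye p (a + b) = ye p a * ye p b := by
    simp [ye, AddMonoidAlgebra.single_mul_single]
  rw [ybar, h, map_mul, ybar, ybar]

/-- The monomials `ȳ^q` generate `A` as a ring. -/
theorem Ap.subring_eq_top (p : ℕ) [Fact p.Prime] (T : Subring (Ap p))
    (hT : ∀ q, ybar p q ∈ T) : T = ⊤ := by
  rw [eq_top_iff]
  rintro a -
  obtain ⟨f, rfl⟩ := Ideal.Quotient.mk_surjective a
  induction f using AddMonoidAlgebra.induction_on with
  | of m => exact hT m
  | add f g hf hg => simpa using T.add_mem hf hg
  | smul c f hf =>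
    have hc : c • f = c.val • f := by
      rw [← Nat.cast_smul_eq_nsmul (ZMod p), ZMod.natCast_zmod_val]
    rw [hc, map_nsmul]
    exact T.nsmul_mem hf _

/-- The monoid `M` is `p`-divisible. -/
theorem Mp.exists_nsmul_eq (p : ℕ) [hp : Fact p.Prime] (q : Mp p) : ∃ s : Mp p, p • s = q := by
  obtain ⟨q, hq, k, m, hm⟩ := q
  have hp0 : (p : ℚ) ≠ 0 := Nat.cast_ne_zero.2 hp.out.ne_zero
  refine ⟨⟨q / p, by positivity, k + 1, m, ?_⟩, Subtype.ext ?_⟩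
  · rw [← hm, pow_succ]
    field_simp
  · simp only [AddSubmonoidClass.coe_nsmul, nsmul_eq_mul]
    field_simp

theorem ybar_nsmul (p n : ℕ) (q : Mp p) : ybar p (n • q) = ybar p q ^ n := by
  induction n with
  | zero => simp [ybar_zero]
  | succ n ih => rw [succ_nsmul, ybar_add, ih, pow_succ]

theorem Ap.frobenius_surjective (p : ℕ) [Fact p.Prime] :
    Function.Surjective (frobenius (Ap p) p) := by
  rw [← RingHom.range_eq_top]
  refine Ap.subring_eq_top p _ fun q => ?_
  obtain ⟨s, rfl⟩ := Mp.exists_nsmul_eq p q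
  exact ⟨ybar p s, (ybar_nsmul p p s).symm⟩

/-- The monoid homomorphism `q ↦ [ȳ^q]` from `M` to `W_r(A)`. -/
noncomputable def teichmullerYbar (p : ℕ) [Fact p.Prime] (r : ℕ) :
    Multiplicative (Mp p) →* TruncatedWittVector p r (Ap p) where
  toFun q := WittVector.truncate r (WittVector.teichmuller p (ybar p q.toAdd))
  map_one' := by simp [ybar_zero]
  map_mul' a b := by simp [ybar_add]

/-- for `r ≥ 1` and `A = F_p[y^{1/p^∞}]/(y)`, the ring homomorphism
`θ : (ℤ/p^r)[M] → W_r(A)` determined by sending the monoid-algebra basis element `y^q`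
to the Teichmüller representative `[ȳ^q]` is well defined and surjective. -/
theorem statement8 (p : ℕ) [hp : Fact p.Prime] (r : ℕ) (hr : 1 ≤ r) :
    ∃ θ : AddMonoidAlgebra (ZMod (p ^ r)) (Mp p) →+* TruncatedWittVector p r (Ap p),
      (∀ q : Mp p, θ (AddMonoidAlgebra.single q 1)
          = WittVector.truncate r (WittVector.teichmuller p (ybar p q))) ∧
      Function.Surjective θ := by
  have hpr := TruncatedWittVector.natCast_p_pow_eq_zero p r (Ap p)
  obtain ⟨f⟩ := nonempty_zmod_ringHom (R := TruncatedWittVector p r (Ap p)) (n := p ^ r)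
    (by rw [Nat.cast_pow, hpr])
  let θ := AddMonoidAlgebra.liftNCRingHom f (teichmullerYbar p r) fun _ _ => Commute.all _ _
  have hθ (q : Mp p) : θ (AddMonoidAlgebra.single q 1)
      = WittVector.truncate r (WittVector.teichmuller p (ybar p q)) := by
    simp [θ, teichmullerYbar]
  refine ⟨θ, hθ, fun x => ?_⟩
  obtain ⟨x, rfl⟩ := WittVector.truncate_surjective p r (Ap p) x
  have hS : (θ.range.comap (WittVector.truncate r)).map WittVector.constantCoeff = ⊤ :=
    Ap.subring_eq_top p _ fun q =>
      ⟨WittVector.teichmuller p (ybar p q), ⟨_, hθ q⟩, WittVector.teichmuller_coeff_zero p _⟩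
  obtain ⟨s, hs, z, rfl⟩ := WittVector.exists_mem_add_mul_p_pow (Ap.frobenius_surjective p)
    (θ.range.comap (WittVector.truncate r))
    (fun a => Subring.mem_map.1 (hS ▸ Subring.mem_top a)) r x
  simpa [hpr] using hs
end

section
/- Fix r ≥ 1 and let A = F_p[y^{1/p^∞}]/(y). As an abelian group, the truncated Witt vector ring W_r(A) is isomorphic to the direct sum Z/p^r ⊕ ⨁_{q} Z/p^{min(r, k(q))}, where q ranges over the elements of Z[1/p] with 0 < q < 1, and k(q) denotes the least natural number k with p^k · q ≥ 1. -/
open DirectSum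

/-- For `q : ℚ`, the least natural number `k` with `p^k · q ≥ 1`. -/
noncomputable def kVal (p : ℕ) (q : ℚ) : ℕ := sInf {k : ℕ | 1 ≤ (p : ℚ) ^ k * q}

/-- The index set: elements `q` of `ℤ[1/p]` with `0 < q < 1`. -/
def Iset (p : ℕ) : Type :=
  {q : ℚ // (∃ (k : ℕ) (m : ℤ), q * (p : ℚ) ^ k = m) ∧ 0 < q ∧ q < 1}

section Witt

open WittVector

variable {p : ℕ} [hp : Fact p.Prime] {A : Type*} [CommRing A]

/-- If `x` and `y` both start in degree `i` and agree there, then `x - y` starts in degree `i + 1`. -/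
theorem WittVector.coeff_sub_eq_zero_of_lt_succ {x y : WittVector p A} {i : ℕ}
    (hx : ∀ k < i, x.coeff k = 0) (hy : ∀ k < i, y.coeff k = 0) (h : x.coeff i = y.coeff i)
    (k : ℕ) (hk : k < i + 1) : (x - y).coeff k = 0 := by
  have hV : x - y = verschiebung^[i] (x.shift i - y.shift i) := by
    rw [iterate_map_sub, ← eq_iterate_verschiebung hx, ← eq_iterate_verschiebung hy]
  rw [hV]
  rcases Nat.lt_succ_iff_lt_or_eq.mp hk with hk | rfl
  · exact iterate_verschiebung_coeff_eq_zero _ hk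
  · have h0 := iterate_verschiebung_coeff (x.shift k - y.shift k) k 0
    rw [zero_add] at h0
    have hsub : (x.shift k - y.shift k).coeff 0 = (x.shift k).coeff 0 - (y.shift k).coeff 0 :=
      map_sub (constantCoeff : WittVector p A →+* A) _ _
    rw [h0, hsub, shift_coeff, shift_coeff, add_zero, h, sub_self]

theorem intCast_pow_char_pow [CharP A p] (m : ℤ) (i : ℕ) : (m : A) ^ p ^ i = m := by
  have h : (m : ZMod p) ^ p ^ i = m := by
    simp
  simpa only [map_pow, map_intCast] using congrArg (ZMod.castHom dvd_rfl A) h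

theorem WittVector.coeff_sum_zsmul_teichmuller_mul_pow [CharP A p] {J : Type*} (y : J → A)
    (s : Finset J) (c : J → ℤ) (i : ℕ) :
    ((∑ j ∈ s, c j • teichmuller p (y j)) * (p : WittVector p A) ^ i).coeff i =
      ∑ j ∈ s, c j • y j ^ p ^ i := by
  have h := mul_pow_charP_coeff_succ (∑ j ∈ s, c j • teichmuller p (y j)) (m := 0) (n := i)
  rw [zero_add] at h
  have h0 : (∑ j ∈ s, c j • teichmuller p (y j)).coeff 0 = ∑ j ∈ s, c j • y j := by
    change constantCoeff _ = _
    rw [map_sum]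
    refine Finset.sum_congr rfl fun j _ => ?_
    rw [map_zsmul]
    exact congrArg _ (teichmuller_coeff_zero p (y j))
  rw [h, h0, sum_pow_char_pow]
  refine Finset.sum_congr rfl fun j _ => ?_
  rw [zsmul_eq_mul, zsmul_eq_mul, mul_pow, intCast_pow_char_pow]

theorem WittVector.pow_nsmul_truncate_teichmuller [CharP A p] {r e : ℕ} {a : A}
    (h : e < r → a ^ p ^ e = 0) :
    p ^ e • truncate r (teichmuller p a) = 0 := by
  have hmul : p ^ e • truncate r (teichmuller p a) =
      truncate r (teichmuller p a * (p : WittVector p A) ^ e) := by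
    simp [nsmul_eq_mul, mul_comm]
  rw [hmul, ← RingHom.mem_ker, mem_ker_truncate]
  intro k hk
  rcases lt_or_ge k e with hke | hke
  · exact mul_pow_charP_coeff_zero _ hke
  · obtain ⟨m, rfl⟩ := Nat.exists_eq_add_of_le' hke
    rw [mul_pow_charP_coeff_succ]
    rcases Nat.eq_zero_or_pos m with rfl | hm
    · rw [teichmuller_coeff_zero]
      exact h (by omega)
    · rw [teichmuller_coeff_pos _ _ _ hm, zero_pow (pow_ne_zero _ hp.out.ne_zero)]

/-- Let `y` be a family of elements of a ring `A` of characteristic `p`, with exponents `e ≤ r`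
such that `y j ^ p ^ e j = 0` whenever `e j < r`. If for every `i < r` the `p ^ i`-th powers of the
`y j` span `A` over `ZMod p`, and those with `i < e j` are linearly independent, then `W_r(A)` is
the direct sum of the groups `ZMod (p ^ e j)` generated by the Teichmüller representatives. -/
theorem WittVector.nonempty_truncated_addEquiv_directSum [CharP A p] [Algebra (ZMod p) A]
    {J : Type*} (r : ℕ) (y : J → A) (e : J → ℕ) (her : ∀ j, e j ≤ r)
    (hy : ∀ j, e j < r → y j ^ p ^ e j = 0)
    (hli : ∀ i < r, LinearIndepOn (ZMod p) (fun j => y j ^ p ^ i) {j | i < e j})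
    (hspan : ∀ i < r, Submodule.span (ZMod p) (Set.range fun j => y j ^ p ^ i) = ⊤) :
    Nonempty (TruncatedWittVector p r A ≃+ ⨁ j, ZMod (p ^ e j)) := by
  classical
  let T (j : J) : TruncatedWittVector p r A := truncate r (teichmuller p (y j))
  have hT (j : J) : p ^ e j • T j = 0 := pow_nsmul_truncate_teichmuller (hy j)
  let g (j : J) : ZMod (p ^ e j) →+ TruncatedWittVector p r A :=
    ZMod.lift (p ^ e j) ⟨(zmultiplesHom _) (T j), by simpa using hT j⟩
  have hg (j : J) (m : ℤ) : g j m = m • T j := by simp [g]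
  let Φ : (⨁ j, ZMod (p ^ e j)) →+ TruncatedWittVector p r A := DirectSum.toAddMonoid g
  have hsum (s : Finset J) (c : J → ℤ) (i : ℕ) :
      Φ (∑ j ∈ s, DirectSum.of (fun j => ZMod (p ^ e j)) j (((p : ℤ) ^ i * c j : ℤ) : ZMod _)) =
        truncate r ((∑ j ∈ s, c j • teichmuller p (y j)) * (p : WittVector p A) ^ i) := by
    rw [map_sum, Finset.sum_mul, map_sum]
    refine Finset.sum_congr rfl fun j _ => ?_
    rw [DirectSum.toAddMonoid_of, hg]
    simp only [T, zsmul_eq_mul, map_mul, map_pow, map_natCast, map_intCast]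
    push_cast
    ring
  have hinj : Function.Injective Φ := by
    refine (injective_iff_map_eq_zero Φ).mpr fun d hd => ?_
    have key (i : ℕ) (hi : i ≤ r) : ∀ j, ∃ m : ℤ, d j = (((p : ℤ) ^ i * m : ℤ) : ZMod _) := by
      induction i with
      | zero => exact fun j => ⟨(d j).cast, by simp⟩
      | succ i ih =>
        choose m hm using ih (by omega)
        have hsupp : ∀ j ∈ DFinsupp.support d, i < e j := by
          intro j hj
          by_contra! hle
          refine (DFinsupp.mem_support_iff.mp hj) ?_
          rw [hm j, ZMod.intCast_zmod_eq_zero_iff_dvd]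
          push_cast
          exact (pow_dvd_pow _ hle).mul_right _
        have hd' : d = ∑ j ∈ DFinsupp.support d,
            DirectSum.of (fun j => ZMod (p ^ e j)) j (((p : ℤ) ^ i * m j : ℤ) : ZMod _) := by
          conv_lhs => rw [← DirectSum.sum_support_of d]
          exact Finset.sum_congr rfl fun j _ => congrArg _ (hm j)
        have hcoeff : ∑ j ∈ DFinsupp.support d, (m j : ZMod p) • y j ^ p ^ i = 0 := by
          rw [hd', hsum, ← RingHom.mem_ker, mem_ker_truncate] at hd
          have := hd i (by omega)
          rw [coeff_sum_zsmul_teichmuller_mul_pow] at this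
          simpa only [Int.cast_smul_eq_zsmul] using this
        have hzero := linearIndepOn_finset_iff.mp ((hli i (by omega)).mono hsupp) _ hcoeff
        intro j
        by_cases hj : j ∈ DFinsupp.support d
        · obtain ⟨c, hc⟩ := (ZMod.intCast_zmod_eq_zero_iff_dvd _ _).mp (hzero j hj)
          exact ⟨c, by rw [hm j, hc, pow_succ, mul_assoc]⟩
        · exact ⟨0, by simpa using hj⟩
    ext j : 1
    obtain ⟨m, hm⟩ := key r le_rfl j
    rw [hm, DirectSum.zero_apply, ZMod.intCast_zmod_eq_zero_iff_dvd]
    push_cast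
    exact (pow_dvd_pow _ (her j)).mul_right _
  have hsurj : Function.Surjective Φ := by
    have key (n : ℕ) : ∀ i, i + n = r → ∀ x : WittVector p A, (∀ k < i, x.coeff k = 0) →
        ∃ d, Φ d = truncate r x := by
      induction n with
      | zero =>
        intro i hi x hx
        refine ⟨0, ?_⟩
        rw [map_zero, eq_comm, ← RingHom.mem_ker, mem_ker_truncate]
        exact fun k hk => hx k (by omega)
      | succ n ih =>
        intro i hi x hx
        have hmem : x.coeff i ∈ Submodule.span (ZMod p) (Set.range fun j => y j ^ p ^ i) := by
          rw [hspan i (by omega)]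
          trivial
        obtain ⟨c, hc⟩ := Finsupp.mem_span_range_iff_exists_finsupp.mp hmem
        let h : WittVector p A :=
          (∑ j ∈ c.support, ((c j).cast : ℤ) • teichmuller p (y j)) * (p : WittVector p A) ^ i
        have hhi : x.coeff i = h.coeff i := by
          rw [coeff_sum_zsmul_teichmuller_mul_pow, ← hc, Finsupp.sum]
          refine Finset.sum_congr rfl fun j _ => ?_
          rw [← Int.cast_smul_eq_zsmul (ZMod p), ZMod.intCast_zmod_cast]
        obtain ⟨d, hd⟩ := ih (i + 1) (by omega) (x - h) (coeff_sub_eq_zero_of_lt_succ hx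
          (fun k hk => mul_pow_charP_coeff_zero _ hk) hhi)
        obtain ⟨d', hd'⟩ : ∃ d', Φ d' = truncate r h :=
          ⟨_, hsum c.support (fun j => ((c j).cast : ℤ)) i⟩
        exact ⟨d + d', by rw [map_add, hd, hd', ← map_add, sub_add_cancel]⟩
    intro x
    obtain ⟨x, rfl⟩ := truncate_surjective p r A x
    exact key r 0 (zero_add r) x fun k hk => absurd hk k.not_lt_zero
  exact ⟨(AddEquiv.ofBijective Φ ⟨hinj, hsurj⟩).symm⟩

end Witt

section Quotient

variable (p : ℕ)

theorem ybar_pow (q : Mp p) (n : ℕ) : ybar p q ^ n = ybar p (n • q) := by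
  have h : ye p q ^ n = ye p (n • q) := by simp only [ye, AddMonoidAlgebra.single_pow, one_pow]
  rw [ybar, ← map_pow, h, ybar]

theorem ybar_eq_zero {q : Mp p} (hq : 1 ≤ (q : ℚ)) : ybar p q = 0 := by
  obtain ⟨q, hq0, k, m, hm⟩ := q
  let q' : Mp p := ⟨q - 1, sub_nonneg.mpr hq, k, m - (p : ℤ) ^ k, by push_cast; rw [← hm]; ring⟩
  rw [ybar, Ideal.Quotient.eq_zero_iff_mem, Ideal.mem_span_singleton]
  refine ⟨ye p q', ?_⟩
  simp only [ye]
  rw [AddMonoidAlgebra.single_mul_single, mul_one]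
  congr 1
  ext
  change q = 1 + (q - 1)
  ring

theorem linearIndependent_ybar :
    LinearIndependent (ZMod p) fun q : {q : Mp p // (q : ℚ) < 1} => ybar p q := by
  rw [linearIndependent_iff']
  intro s c hc q hq
  have hmk : Ideal.Quotient.mk (Ideal.span {ye p (oneM p)}) (∑ q ∈ s, c q • ye p q) = 0 := by
    rw [map_sum]
    exact hc
  rw [Ideal.Quotient.eq_zero_iff_mem, Ideal.mem_span_singleton] at hmk
  obtain ⟨a, ha⟩ := hmk
  have hcoeff : (∑ q ∈ s, c q • ye p q).coeff q.1 = 0 := by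
    rw [ha, ye, AddMonoidAlgebra.coeff_single_mul_of_forall_add_ne]
    intro d hd
    have h1 : 1 + (d : ℚ) = q.1 := congrArg Subtype.val hd
    have h2 : (0 : ℚ) ≤ d := d.2.1
    linarith [q.2]
  classical
  simpa [ye, AddMonoidAlgebra.coeff_sum, Finsupp.single_apply, Subtype.val_inj, hq] using hcoeff

theorem span_range_ybar : Submodule.span (ZMod p) (Set.range (ybar p)) = ⊤ := by
  refine eq_top_iff.mpr fun a _ => ?_
  obtain ⟨a, rfl⟩ := Ideal.Quotient.mk_surjective a
  induction a using AddMonoidAlgebra.induction_linear with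
  | zero => simp
  | add f g hf hg => rw [map_add]; exact add_mem (hf trivial) (hg trivial)
  | single q c =>
    have h : (AddMonoidAlgebra.single q c : Rp p) = c • ye p q := by simp [ye]
    rw [h]
    exact Submodule.smul_mem _ c (Submodule.subset_span (Set.mem_range_self q))

instance Ap.charP [hp : Fact p.Prime] : CharP (Ap p) p := by
  have : Nontrivial (Ap p) :=
    nontrivial_of_ne (ybar p 0) 0 <|
      (linearIndependent_ybar p).ne_zero (i := ⟨0, one_pos⟩)
  exact charP_of_injective_algebraMap (algebraMap (ZMod p) (Ap p)).injective p

/-- The exponents in `[0, 1)`, with `none` standing for `0`. -/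
def exponent : Option (Iset p) → Mp p
  | none => 0
  | some q => ⟨q.1, q.2.2.1.le, q.2.1⟩

theorem exponent_injective : Function.Injective (exponent p) := by
  rintro (_ | a) (_ | b) h
  · rfl
  · exact absurd (congrArg Subtype.val h) b.2.2.1.ne
  · exact absurd (congrArg Subtype.val h) a.2.2.1.ne'
  · exact congrArg some (Subtype.ext (congrArg (fun q : Mp p => (q : ℚ)) h))

theorem exists_exponent_eq {q : Mp p} (hq : (q : ℚ) < 1) : ∃ j, exponent p j = q := by
  rcases q.2.1.eq_or_lt with h | h
  · exact ⟨none, Subtype.ext h⟩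
  · exact ⟨some ⟨q, q.2.2, h, hq⟩, rfl⟩

variable {p}

/-- Every element of `Mp p` is divisible by every power of `p`. -/
theorem exists_pow_nsmul_eq (hp : p ≠ 0) (q : Mp p) (i : ℕ) : ∃ q' : Mp p, p ^ i • q' = q := by
  obtain ⟨q, hq0, k, m, hm⟩ := q
  have hp' : (p : ℚ) ≠ 0 := Nat.cast_ne_zero.mpr hp
  refine ⟨⟨q / (p : ℚ) ^ i, by positivity, i + k, m, ?_⟩, ?_⟩
  · rw [pow_add, ← hm]
    field_simp
  · ext
    change p ^ i • (q / (p : ℚ) ^ i) = q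
    rw [nsmul_eq_mul]
    push_cast
    field_simp

theorem one_le_pow_kVal_mul (hp : 1 < p) {q : ℚ} (hq : 0 < q) : 1 ≤ (p : ℚ) ^ kVal p q * q := by
  refine Nat.sInf_mem (s := {k : ℕ | 1 ≤ (p : ℚ) ^ k * q}) ?_
  obtain ⟨k, hk⟩ := pow_unbounded_of_one_lt q⁻¹ (Nat.one_lt_cast.mpr hp : (1 : ℚ) < p)
  exact ⟨k, ((inv_lt_iff_one_lt_mul₀ hq).mp hk).le⟩

end Quotient

/-- for `r ≥ 1` and `A = F_p[y^{1/p^∞}]/(y)`, as an abelian group,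
`W_r(A)` is isomorphic to `ℤ/p^r ⊕ ⨁_q ℤ/p^{min(r, k(q))}`, where `q` ranges over the
elements of `ℤ[1/p]` with `0 < q < 1` and `k(q)` is the least `k` with `p^k · q ≥ 1`. -/
theorem statement10 (p : ℕ) [hp : Fact p.Prime] (r : ℕ) (hr : 1 ≤ r) :
    Nonempty (TruncatedWittVector p r (Ap p) ≃+
      (ZMod (p ^ r) × ⨁ q : Iset p, ZMod (p ^ min r (kVal p q.val)))) := by
  let e : Option (Iset p) → ℕ := fun j => j.elim r fun q => min r (kVal p q.val)
  have hcoe (i : ℕ) (q : Mp p) : ((p ^ i • q : Mp p) : ℚ) = (p : ℚ) ^ i * q := by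
    rw [AddSubmonoidClass.coe_nsmul, nsmul_eq_mul, Nat.cast_pow]
  have hlt (i : ℕ) (j : Option (Iset p)) (hj : i < e j) :
      ((p ^ i • exponent p j : Mp p) : ℚ) < 1 := by
    rw [hcoe]
    rcases j with _ | q
    · simp [exponent]
    · exact not_le.mp (Nat.notMem_of_lt_sInf (hj.trans_le (min_le_right _ _)))
  refine (WittVector.nonempty_truncated_addEquiv_directSum (p := p) r
    (fun j => ybar p (exponent p j)) e ?_ ?_ ?_ ?_).map fun E =>
    E.trans DirectSum.addEquivProdDirectSum
  · rintro (_ | q)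
    · exact le_rfl
    · exact min_le_left _ _
  · rintro (_ | q) hj
    · exact absurd hj (lt_irrefl r)
    · have he : e (some q) = kVal p q.val := by
        change min r _ < r at hj
        change min r _ = _
        omega
      rw [ybar_pow, he]
      refine ybar_eq_zero p ?_
      rw [hcoe]
      exact one_le_pow_kVal_mul hp.out.one_lt q.2.2.1
  · intro i _
    simp only [ybar_pow]
    refine (linearIndependent_ybar p).comp
      (fun j : {j | i < e j} => ⟨p ^ i • exponent p j, hlt i j j.2⟩) fun a b hab => ?_
    have h := congrArg (fun q => (q.1 : ℚ)) hab
    simp only [hcoe] at h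
    exact Subtype.ext (exponent_injective p (Subtype.ext
      (mul_left_cancel₀ (pow_ne_zero i (Nat.cast_ne_zero.mpr hp.out.ne_zero)) h)))
  · intro i _
    rw [eq_top_iff, ← span_range_ybar, Submodule.span_le]
    rintro _ ⟨q, rfl⟩
    obtain ⟨q', rfl⟩ := exists_pow_nsmul_eq hp.out.ne_zero q i
    rw [← ybar_pow]
    rcases lt_or_ge (q' : ℚ) 1 with hq | hq
    · obtain ⟨j, rfl⟩ := exists_exponent_eq p hq
      exact Submodule.subset_span ⟨j, rfl⟩
    · rw [ybar_eq_zero p hq, zero_pow (pow_ne_zero i hp.out.ne_zero)]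
      exact zero_mem _
end
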